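/- Let G be a group acting on a probability space (B,ν) by measurable transformations preserving the measure class of ν (for each g ∈ G, a set is ν-null if and only if its image under g is ν-null). Let φ : B → S¹ be a measurable map such that the pushforward φ_*ν is atomless and has support equal to all of S¹, and suppose that for every g ∈ G, o(φ(g·x),φ(g·y),φ(g·z)) = o(φ(x),φ(y),φ(z)) for ν³-almost every (x,y,z) ∈ B³. Then for every g ∈ G there exists a unique orientation-preserving homeomorphism π(g) ∈ Homeo⁺(S¹) with π(g)(φ(x)) = φ(g·x) for ν-almost every x ∈ B, and the map π : G → Homeo⁺(S¹) is a group homomorphism. -/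

import Mathlib

open Filter MeasureTheory Set
open scoped Classical

noncomputable section

/-- The circle `S¹ = ℝ/ℤ`. -/
abbrev S1 : Type := AddCircle (1 : ℝ)

/-- `F : ℝ → ℝ` is an increasing homeomorphism of `ℝ` commuting with integer
translations which is a lift of `f : S¹ → S¹`. -/
def IsCircleLift (f : S1 → S1) (F : ℝ → ℝ) : Prop :=
  StrictMono F ∧ Function.Surjective F ∧ (∀ x, F (x + 1) = F x + 1) ∧
    ∀ x : ℝ, f (x : S1) = (F x : S1)

/-- `f` is an orientation preserving homeomorphism of the circle. -/
def IsOPH (f : S1 → S1) : Prop := ∃ F, IsCircleLift f F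

/-- The unique lift `f̄` of `f ∈ Homeo⁺(S¹)` with `f̄ 0 ∈ [0,1)`. -/
def posLift (f : S1 → S1) : ℝ → ℝ :=
  if h : ∃ F, IsCircleLift f F ∧ F 0 ∈ Set.Ico (0 : ℝ) 1 then h.choose else id

/-- The Euler cocycle `c(f,g)`, defined by `f̄(ḡ(x)) = (f∘g)‾(x) + c(f,g)` where
`f̄` denotes the lift of `f` with `f̄ 0 ∈ [0,1)`. -/
def euler (f g : S1 → S1) : ℝ :=
  posLift f (posLift g 0) - posLift (fun x => f (g x)) 0

/-- A quasi-conjugacy: a self-map of the circle induced by a monotone increasing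
map of `ℝ` commuting with integer translations. -/
def IsQuasiConjMap (h : S1 → S1) : Prop :=
  ∃ H : ℝ → ℝ, Monotone H ∧ (∀ x, H (x + 1) = H x + 1) ∧ ∀ x : ℝ, h (x : S1) = (H x : S1)

/-- `ρ₀` and `ρ₁` are quasi-conjugate: there is a quasi-conjugacy `h` with
`h ∘ ρ₀ γ = ρ₁ γ ∘ h` for all `γ`. -/
def QuasiConj {Γ : Type*} (ρ₀ ρ₁ : Γ → S1 → S1) : Prop :=
  ∃ h, IsQuasiConjMap h ∧ ∀ γ, h ∘ ρ₀ γ = ρ₁ γ ∘ h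

/-- `ρ` is an action of `Γ` on the circle by orientation preserving homeomorphisms,
i.e. a homomorphism `Γ → Homeo⁺(S¹)`. -/
def IsCircleAction (Γ : Type*) [Group Γ] (ρ : Γ → S1 → S1) : Prop :=
  (∀ γ, IsOPH (ρ γ)) ∧ ρ 1 = id ∧ ∀ γ η, ρ (γ * η) = ρ γ ∘ ρ η

/-- `(x,y,z)` is a positively oriented triple of pairwise distinct points on the
circle. -/
def PosOriented (x y z : S1) : Prop :=
  ∃ a b c : ℝ, (a : S1) = x ∧ (b : S1) = y ∧ (c : S1) = z ∧ a < b ∧ b < c ∧ c < a + 1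

/-- The orientation cocycle `o : (S¹)³ → {-1,0,1}`. -/
def orient (x y z : S1) : ℝ :=
  if PosOriented x y z then 1 else if PosOriented z y x then -1 else 0

/-- The support of a measure: the set of points all of whose neighbourhoods have
positive measure. -/
def measSupport {α : Type*} [TopologicalSpace α] [MeasurableSpace α]
    (μ : Measure α) : Set α :=
  {x | ∀ U ∈ nhds x, 0 < μ U}

/-! ### Orientation preserving homeomorphisms -/

lemma IsOPH.continuous {f : S1 → S1} (hf : IsOPH f) : Continuous f := by
  obtain ⟨F, hmono, hsurj, -, hF⟩ := hf
  have hcont : Continuous F := hmono.monotone.continuous_of_surjective hsurj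
  refine (QuotientAddGroup.isQuotientMap_mk (N := AddSubgroup.zmultiples (1 : ℝ))).continuous_iff.2 ?_
  have : f ∘ ((↑) : ℝ → S1) = fun x => (F x : S1) := funext hF
  exact this ▸ (AddCircle.continuous_mk' 1).comp hcont

lemma IsOPH.comp {f k : S1 → S1} (hf : IsOPH f) (hk : IsOPH k) : IsOPH (f ∘ k) := by
  obtain ⟨F, hF, hFs, hF1, hFl⟩ := hf
  obtain ⟨K, hK, hKs, hK1, hKl⟩ := hk
  exact ⟨F ∘ K, hF.comp hK, hFs.comp hKs, fun x => by simp [hK1, hF1],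
    fun x => by simp [hKl, hFl]⟩

lemma isOPH_id : IsOPH id :=
  ⟨id, strictMono_id, Function.surjective_id, fun _ => rfl, fun _ => rfl⟩

lemma IsOPH.exists_leftInverse {f : S1 → S1} (hf : IsOPH f) :
    ∃ k, IsOPH k ∧ Function.LeftInverse k f := by
  obtain ⟨F, hF, hFs, hF1, hFl⟩ := hf
  let e := hF.orderIsoOfSurjective F hFs
  have he : ∀ x, e x = F x := fun _ => rfl
  have hsymm : ∀ x, e.symm (x + 1) = e.symm x + 1 := fun x => by
    rw [OrderIso.symm_apply_eq, he, hF1, ← he, e.apply_symm_apply]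
  have hper : Function.Periodic (fun x => (e.symm x : S1)) 1 := fun x => by
    simp only [hsymm, AddCircle.coe_add_period]
  refine ⟨hper.lift, ⟨e.symm, e.symm.strictMono, e.symm.surjective, hsymm, hper.lift_coe⟩, ?_⟩
  intro x
  obtain ⟨t, rfl⟩ := QuotientAddGroup.mk_surjective x
  have h1 : f (t : S1) = (F t : S1) := hFl t
  refine (congrArg hper.lift h1).trans ((hper.lift_coe (F t)).trans ?_)
  rw [← he, e.symm_apply_apply]

lemma strictMono_floor_add_fract {c : ℝ → ℝ} (hc : StrictMonoOn c (Icc 0 1)) (h0 : c 0 = 0)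
    (h1 : c 1 = 1) : StrictMono fun x : ℝ => (⌊x⌋ : ℝ) + c (Int.fract x) := by
  intro x y hxy
  have hmem : ∀ z : ℝ, Int.fract z ∈ Icc (0 : ℝ) 1 := fun z =>
    ⟨Int.fract_nonneg z, (Int.fract_lt_one z).le⟩
  rcases (Int.floor_mono hxy.le).eq_or_lt with h | h
  · have : Int.fract x < Int.fract y := by
      rw [Int.fract, Int.fract, h]; linarith
    have := hc (hmem x) (hmem y) this
    simp only [h]; linarith
  · have hx : c (Int.fract x) < 1 := h1 ▸ hc (hmem x) ⟨zero_le_one, le_rfl⟩ (Int.fract_lt_one x)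
    have hy : 0 ≤ c (Int.fract y) :=
      h0 ▸ hc.monotoneOn ⟨le_rfl, zero_le_one⟩ (hmem y) (Int.fract_nonneg y)
    have : (⌊x⌋ : ℝ) + 1 ≤ ⌊y⌋ := by exact_mod_cast h
    linarith

lemma surjective_floor_add_fract {c : ℝ → ℝ} (hc : StrictMonoOn c (Icc 0 1))
    (hcont : ContinuousOn c (Icc 0 1)) (h0 : c 0 = 0) (h1 : c 1 = 1) :
    Function.Surjective fun x : ℝ => (⌊x⌋ : ℝ) + c (Int.fract x) := by
  have hmem : ∀ z : ℝ, Int.fract z ∈ Icc (0 : ℝ) 1 := fun z =>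
    ⟨Int.fract_nonneg z, (Int.fract_lt_one z).le⟩
  have hbd : ∀ z : ℝ, 0 ≤ c (Int.fract z) ∧ c (Int.fract z) ≤ 1 := fun z =>
    ⟨h0 ▸ hc.monotoneOn ⟨le_rfl, zero_le_one⟩ (hmem z) (hmem z).1,
      h1 ▸ hc.monotoneOn (hmem z) ⟨zero_le_one, le_rfl⟩ (hmem z).2⟩
  have hA : Continuous fun x : ℝ => (⌊x⌋ : ℝ) + c (Int.fract x) := by
    have hd : ContinuousOn (fun t => c t - t) (Icc 0 1) := hcont.sub continuousOn_id
    have := continuous_id.add (hd.comp_fract'' (by simp [h0, h1]))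
    refine this.congr fun x => ?_
    have := Int.floor_add_fract x
    change x + (c (Int.fract x) - Int.fract x) = ⌊x⌋ + c (Int.fract x)
    linarith
  refine hA.surjective ?_ ?_
  · refine tendsto_atTop_mono (fun x => ?_) (tendsto_atTop_add_const_right _ (-1) tendsto_id)
    have := Int.lt_floor_add_one x
    have := (hbd x).1
    simp only [id]; linarith
  · refine tendsto_atBot_mono (fun x => ?_) (tendsto_atBot_add_const_right _ 1 tendsto_id)
    have := Int.floor_le x
    have := (hbd x).2
    simp only [id]; linarith

/-! ### The coordinate on the circle based at a point -/

/-- The representative in `[0,1)` of `x - p`. -/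
def arcCoord (p x : S1) : ℝ := AddCircle.equivIco (1 : ℝ) 0 (x - p)

lemma coe_arcCoord (p x : S1) : (arcCoord p x : S1) = x - p := AddCircle.coe_equivIco

lemma arcCoord_nonneg (p x : S1) : 0 ≤ arcCoord p x :=
  (AddCircle.equivIco (1 : ℝ) 0 (x - p)).2.1

lemma arcCoord_lt_one (p x : S1) : arcCoord p x < 1 :=
  (AddCircle.equivIco (1 : ℝ) 0 (x - p)).2.2.trans_eq (zero_add 1)

lemma arcCoord_coe_coe (s t : ℝ) : arcCoord (s : S1) (t : S1) = Int.fract (t - s) := by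
  refine (AddCircle.coe_equivIco_mk_apply (p := (1 : ℝ)) (t - s)).trans ?_
  rw [div_one, mul_one]

lemma arcCoord_eq_zero_iff {p x : S1} : arcCoord p x = 0 ↔ x = p := by
  constructor
  · intro h
    have := coe_arcCoord p x
    rw [h] at this
    exact (sub_eq_zero.1 (by simpa using this.symm))
  · rintro rfl
    obtain ⟨t, rfl⟩ := QuotientAddGroup.mk_surjective x
    exact (arcCoord_coe_coe t t).trans (by simp)

lemma measurable_arcCoord (p : S1) : Measurable (arcCoord p) :=
  measurable_subtype_coe.comp
    ((AddCircle.measurableEquivIco (1 : ℝ) 0).measurable.comp (measurable_id.sub_const p))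

lemma isOpen_arcCoord_preimage_Ioo (p : S1) {s t : ℝ} (hs : 0 ≤ s) (ht : t ≤ 1) :
    IsOpen (arcCoord p ⁻¹' Ioo s t) := by
  obtain ⟨P, rfl⟩ := QuotientAddGroup.mk_surjective p
  have : arcCoord (P : S1) ⁻¹' Ioo s t = ((↑) : ℝ → S1) '' Ioo (P + s) (P + t) := by
    ext x
    constructor
    · rintro ⟨h1, h2⟩
      refine ⟨P + arcCoord (P : S1) x, ⟨by linarith, by linarith⟩, ?_⟩
      rw [AddCircle.coe_add, coe_arcCoord]; abel
    · rintro ⟨u, ⟨h1, h2⟩, rfl⟩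
      have : arcCoord (P : S1) (u : S1) = u - P := by
        rw [arcCoord_coe_coe, Int.fract_eq_self]
        constructor <;> linarith
      rw [mem_preimage, this]
      constructor <;> linarith
  refine this ▸ QuotientAddGroup.isOpenMap_coe _ isOpen_Ioo

lemma nonempty_arcCoord_preimage_Ioo (p : S1) {s t : ℝ} (hs : 0 ≤ s) (hst : s < t) (ht : t ≤ 1) :
    (arcCoord p ⁻¹' Ioo s t).Nonempty := by
  obtain ⟨P, rfl⟩ := QuotientAddGroup.mk_surjective p
  refine ⟨((P + (s + t) / 2 : ℝ) : S1), ?_⟩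
  have : arcCoord (P : S1) ((P + (s + t) / 2 : ℝ) : S1) = (s + t) / 2 := by
    rw [arcCoord_coe_coe, add_sub_cancel_left, Int.fract_eq_self]
    constructor <;> linarith
  refine mem_preimage.2 (this.symm ▸ ?_)
  constructor <;> linarith

lemma posOriented_iff_arcCoord {p y z : S1} :
    PosOriented p y z ↔ 0 < arcCoord p y ∧ arcCoord p y < arcCoord p z := by
  constructor
  · rintro ⟨a, b, c, rfl, rfl, rfl, hab, hbc, hca⟩
    rw [arcCoord_coe_coe, arcCoord_coe_coe, Int.fract_eq_self.2 ⟨by linarith, by linarith⟩,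
      Int.fract_eq_self.2 ⟨by linarith, by linarith⟩]
    constructor <;> linarith
  · rintro ⟨hy, hyz⟩
    obtain ⟨P, rfl⟩ := QuotientAddGroup.mk_surjective p
    have := arcCoord_lt_one (P : S1) z
    refine ⟨P, P + arcCoord (P : S1) y, P + arcCoord (P : S1) z, rfl, ?_, ?_, ?_, ?_, ?_⟩
    · rw [AddCircle.coe_add, coe_arcCoord]; abel
    · rw [AddCircle.coe_add, coe_arcCoord]; abel
    · exact lt_add_of_pos_right _ hy
    · exact add_lt_add_right hyz _
    · exact add_lt_add_right this _

lemma orient_eq_one_iff {x y z : S1} : orient x y z = 1 ↔ PosOriented x y z := by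
  unfold orient
  split_ifs <;> norm_num <;> assumption

/-! ### The homeomorphism straightening a measure -/

lemma continuous_cdf_of_nullSingletonClass (α : Measure ℝ) [IsProbabilityMeasure α] [NullSingletonClass α] :
    Continuous (ProbabilityTheory.cdf α) := by
  refine continuous_iff_continuousAt.2 fun x => ?_
  have hmono := ProbabilityTheory.monotone_cdf α
  have hx : (ProbabilityTheory.cdf α).measure {x} = 0 := by
    rw [ProbabilityTheory.measure_cdf]; exact measure_singleton x
  rw [StieltjesFunction.measure_singleton, ENNReal.ofReal_eq_zero] at hx
  refine continuousAt_iff_continuous_left'_right'.2 ⟨?_, ?_⟩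
  · rw [hmono.continuousWithinAt_Iio_iff_leftLim_eq]
    exact le_antisymm (hmono.leftLim_le le_rfl) (by linarith)
  · exact ((ProbabilityTheory.cdf α).right_continuous x).mono Ioi_subset_Ici_self

lemma isOPH_cdf_arcCoord (μ : Measure S1) [IsProbabilityMeasure μ]
    (hatom : ∀ x, μ {x} = 0) (hopen : ∀ U : Set S1, IsOpen U → U.Nonempty → μ U ≠ 0) (p : S1) :
    IsOPH (fun x => (ProbabilityTheory.cdf (μ.map (arcCoord p)) (arcCoord p x) : S1)) := by
  have hm := measurable_arcCoord p
  have : IsProbabilityMeasure (μ.map (arcCoord p)) := Measure.isProbabilityMeasure_map hm.aemeasurable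
  have : NullSingletonClass (μ.map (arcCoord p)) := by
    refine ⟨fun t => ?_⟩
    rw [Measure.map_apply hm (measurableSet_singleton t)]
    refine measure_mono_null (t := {(t : S1) + p}) (fun x hx => ?_) (hatom _)
    have := coe_arcCoord p x
    rw [mem_preimage, mem_singleton_iff] at hx
    rw [hx] at this
    rw [mem_singleton_iff, this]; abel
  set c := ProbabilityTheory.cdf (μ.map (arcCoord p)) with hc
  have hstrict : StrictMonoOn c (Icc 0 1) := by
    intro s hs t ht hst
    have h := StieltjesFunction.measure_Ioc c s t
    rw [hc, ProbabilityTheory.measure_cdf, ← hc, Measure.map_apply hm measurableSet_Ioc] at h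
    have hpos : 0 < μ (arcCoord p ⁻¹' Ioc s t) :=
      (pos_iff_ne_zero.2 (hopen _ (isOpen_arcCoord_preimage_Ioo p hs.1 ht.2)
        (nonempty_arcCoord_preimage_Ioo p hs.1 hst ht.2))).trans_le
        (measure_mono (preimage_mono Ioo_subset_Ioc_self))
    rw [h, ENNReal.ofReal_pos] at hpos
    linarith
  have h0 : c 0 = 0 := by
    rw [hc, ProbabilityTheory.cdf_eq_real, measureReal_eq_zero_iff,
      Measure.map_apply hm measurableSet_Iic]
    refine measure_mono_null (fun x hx => ?_) (hatom p)
    exact arcCoord_eq_zero_iff.1 (le_antisymm hx (arcCoord_nonneg p x))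
  have h1 : c 1 = 1 := by
    rw [hc, ProbabilityTheory.cdf_eq_real, Measure.real, Measure.map_apply hm measurableSet_Iic,
      eq_univ_of_forall (s := arcCoord p ⁻¹' Iic 1) fun x => (arcCoord_lt_one p x).le]
    simp
  have hcont : ContinuousOn c (Icc 0 1) := (continuous_cdf_of_nullSingletonClass _).continuousOn
  obtain ⟨P, rfl⟩ := QuotientAddGroup.mk_surjective p
  refine ⟨fun x => ⌊x - P⌋ + c (Int.fract (x - P)), ?_, ?_, ?_, ?_⟩
  · exact (strictMono_floor_add_fract hstrict h0 h1).comp fun x y h => sub_lt_sub_right h P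
  · exact (surjective_floor_add_fract hstrict hcont h0 h1).comp fun y => ⟨y + P, add_sub_cancel_right y P⟩
  · intro x
    simp only [add_sub_right_comm x 1 P, Int.floor_add_one, Int.fract_add_one]
    push_cast; ring
  · intro x
    have h : arcCoord (QuotientAddGroup.mk P : S1) (x : S1) = Int.fract (x - P) :=
      arcCoord_coe_coe P x
    have hn : ((⌊x - P⌋ : ℝ) : S1) = 0 := by
      rw [AddCircle.coe_eq_zero_iff]; exact ⟨⌊x - P⌋, by simp⟩
    simp only [h, AddCircle.coe_add, hn, zero_add]

/-! ### Measurable maps with the same orientation cocycle -/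

lemma exists_isOPH_of_orient_ae_eq {B : Type*} [MeasurableSpace B] (ν : Measure B)
    [IsProbabilityMeasure ν] {φ ψ : B → S1} (hφ : Measurable φ) (hψ : Measurable ψ)
    (hφa : ∀ x, ν.map φ {x} = 0) (hψa : ∀ x, ν.map ψ {x} = 0)
    (hφo : ∀ U : Set S1, IsOpen U → U.Nonempty → ν.map φ U ≠ 0)
    (hψo : ∀ U : Set S1, IsOpen U → U.Nonempty → ν.map ψ U ≠ 0)
    (ho : ∀ᵐ p : B × B × B ∂(ν.prod (ν.prod ν)),
      orient (ψ p.1) (ψ p.2.1) (ψ p.2.2) = orient (φ p.1) (φ p.2.1) (φ p.2.2)) :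
    ∃ h, IsOPH h ∧ ∀ᵐ x ∂ν, h (φ x) = ψ x := by
  have : IsProbabilityMeasure (ν.map φ) := Measure.isProbabilityMeasure_map hφ.aemeasurable
  have : IsProbabilityMeasure (ν.map ψ) := Measure.isProbabilityMeasure_map hψ.aemeasurable
  obtain ⟨x₀, hx₀⟩ := (Measure.ae_ae_of_ae_prod ho).exists
  have hx := Measure.ae_ae_of_ae_prod hx₀
  have hp := isOPH_cdf_arcCoord (ν.map φ) hφa hφo (φ x₀)
  obtain ⟨k, hk, hkq⟩ := (isOPH_cdf_arcCoord (ν.map ψ) hψa hψo (ψ x₀)).exists_leftInverse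
  refine ⟨_, hk.comp hp, ?_⟩
  have hpos : ∀ {χ : B → S1}, Measurable χ → (∀ x, ν.map χ {x} = 0) →
      ∀ᵐ y ∂ν, 0 < arcCoord (χ x₀) (χ y) := by
    intro χ hχ hχa
    have h := hχa (χ x₀)
    rw [Measure.map_apply hχ (measurableSet_singleton _)] at h
    filter_upwards [measure_eq_zero_iff_ae_notMem.1 h] with y hy
    exact (arcCoord_nonneg _ _).lt_of_ne fun h => hy (arcCoord_eq_zero_iff.1 h.symm)
  have hcdf : ∀ {χ : B → S1}, Measurable χ → ∀ (p : S1) (t : ℝ),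
      ProbabilityTheory.cdf ((ν.map χ).map (arcCoord p)) t
        = 1 - ν.real {z | t < arcCoord p (χ z)} := by
    intro χ hχ p t
    have hm := (measurable_arcCoord p).comp hχ
    rw [Measure.map_map (measurable_arcCoord p) hχ]
    have := Measure.isProbabilityMeasure_map (μ := ν) hm.aemeasurable
    rw [ProbabilityTheory.cdf_eq_real, ← compl_Ioi, probReal_compl_eq_one_sub measurableSet_Ioi,
      map_measureReal_apply hm measurableSet_Ioi]
    rfl
  filter_upwards [hx, hpos hφ hφa, hpos hψ hψa] with y hy hyφ hyψ
  have hset : ν.real {z | arcCoord (φ x₀) (φ y) < arcCoord (φ x₀) (φ z)}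
      = ν.real {z | arcCoord (ψ x₀) (ψ y) < arcCoord (ψ x₀) (ψ z)} := by
    refine measureReal_congr ?_
    filter_upwards [hy] with z hz
    have h := (orient_eq_one_iff (x := ψ x₀) (y := ψ y) (z := ψ z)).symm.trans
      ((Eq.congr_left hz).trans orient_eq_one_iff)
    rw [posOriented_iff_arcCoord, posOriented_iff_arcCoord, and_iff_right hyφ,
      and_iff_right hyψ] at h
    exact propext h.symm
  have hval := congrArg (fun t : ℝ => ((1 - t : ℝ) : S1)) hset
  simp only [← hcdf hφ, ← hcdf hψ] at hval
  simp only [Function.comp_apply, hval]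
  exact hkq (ψ y)

lemma IsOPH.eq_of_ae_eq {B : Type*} [MeasurableSpace B] {ν : Measure B} {φ : B → S1}
    (hφ : Measurable φ) (hφo : ∀ U : Set S1, IsOpen U → U.Nonempty → ν.map φ U ≠ 0)
    {h k : S1 → S1} (hh : IsOPH h) (hk : IsOPH k) (hae : ∀ᵐ x ∂ν, h (φ x) = k (φ x)) : h = k := by
  have hopen : IsOpen {x | h x ≠ k x} := isOpen_ne_fun hh.continuous hk.continuous
  funext x
  by_contra hx
  refine hφo _ hopen ⟨x, hx⟩ ?_
  rw [Measure.map_apply hφ hopen.measurableSet]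
  exact hae

/-- Let `G` act on a probability space `(B,ν)` by measurable transformations
preserving the measure class of `ν`, and let `φ : B → S¹` be measurable with atomless,
fully supported distribution, such that the orientation cocycle pulled back by `φ` is
`G`-invariant almost everywhere.  Then for each `g ∈ G` there is a unique orientation
preserving homeomorphism `π(g)` with `π(g)(φ(x)) = φ(g·x)` a.e., and `π` is a group
homomorphism `G → Homeo⁺(S¹)`. -/
theorem equivariant_homeomorphism_from_measurable_map
    {G B : Type*} [Group G] [MeasurableSpace B] [MulAction G B]
    (ν : Measure B) [IsProbabilityMeasure ν]
    (hmeas : ∀ g : G, Measurable fun x : B => g • x)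
    (hqm : ∀ (g : G) (E : Set B), ν E = 0 ↔ ν ((fun x : B => g • x) '' E) = 0)
    (φ : B → S1) (hφ : Measurable φ)
    (hatomless : ∀ x : S1, Measure.map φ ν {x} = 0)
    (hsupp : measSupport (Measure.map φ ν) = Set.univ)
    (horient : ∀ g : G, ∀ᵐ p : B × B × B ∂(ν.prod (ν.prod ν)),
      orient (φ (g • p.1)) (φ (g • p.2.1)) (φ (g • p.2.2)) =
        orient (φ p.1) (φ p.2.1) (φ p.2.2)) :
    (∀ g : G, ∃! h : S1 → S1, IsOPH h ∧ ∀ᵐ x ∂ν, h (φ x) = φ (g • x)) ∧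
    ∃ π : G → S1 → S1,
      (∀ g : G, IsOPH (π g) ∧ ∀ᵐ x ∂ν, π g (φ x) = φ (g • x)) ∧
      π 1 = id ∧ ∀ g h : G, π (g * h) = π g ∘ π h := by
  have hae : ∀ (g : G) {P : B → Prop}, (∀ᵐ x ∂ν, P x) → ∀ᵐ x ∂ν, P (g • x) := by
    intro g P hP
    refine (hqm g {x | ¬ P (g • x)}).2 (measure_mono_null ?_ hP)
    rintro _ ⟨x, hx, rfl⟩
    exact hx
  have hopen : ∀ U : Set S1, IsOpen U → U.Nonempty → ν.map φ U ≠ 0 := by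
    rintro U hU ⟨x, hx⟩
    have : x ∈ measSupport (ν.map φ) := hsupp ▸ mem_univ x
    exact (this U (hU.mem_nhds hx)).ne'
  have hex : ∀ g : G, ∃ h : S1 → S1, IsOPH h ∧ ∀ᵐ x ∂ν, h (φ x) = φ (g • x) := by
    intro g
    have hm : Measurable fun x => φ (g • x) := hφ.comp (hmeas g)
    refine exists_isOPH_of_orient_ae_eq ν hφ hm hatomless (fun x => ?_) hopen
      (fun U hU hne h => hopen U hU hne ?_) (horient g)
    · have h := hatomless x
      rw [Measure.map_apply hφ (measurableSet_singleton x)] at h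
      rw [Measure.map_apply hm (measurableSet_singleton x)]
      exact measure_eq_zero_iff_ae_notMem.2 (hae g (measure_eq_zero_iff_ae_notMem.1 h))
    · rw [Measure.map_apply hm hU.measurableSet] at h
      rw [Measure.map_apply hφ hU.measurableSet]
      refine measure_eq_zero_iff_ae_notMem.2 ?_
      filter_upwards [hae g⁻¹ (measure_eq_zero_iff_ae_notMem.1 h)] with x hx
      simpa using hx
  choose π hπ hπae using hex
  refine ⟨fun g => ⟨π g, ⟨hπ g, hπae g⟩, ?_⟩, π, fun g => ⟨hπ g, hπae g⟩, ?_, fun g h => ?_⟩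
  · rintro k ⟨hk, hkae⟩
    refine hk.eq_of_ae_eq hφ hopen (hπ g) ?_
    filter_upwards [hkae, hπae g] with x h1 h2 using h1.trans h2.symm
  · refine (hπ 1).eq_of_ae_eq hφ hopen isOPH_id ?_
    filter_upwards [hπae 1] with x hx
    simpa using hx
  · refine (hπ (g * h)).eq_of_ae_eq hφ hopen ((hπ g).comp (hπ h)) ?_
    filter_upwards [hπae (g * h), hπae h, hae h (hπae g)] with x h1 h2 h3
    rw [h1, Function.comp_apply, h2, h3, mul_smul]

end
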